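/- arXiv:0712.4027 — 3 statements merged into one kernel-verified Lean document; each statement's English description precedes it below -/
import Mathlib

section
/- Let p be a non-constant polynomial in n complex variables and let V(p) = {z ∈ ℂⁿ : p(z) = 0}. Then dim_ℂ(V(p)) = n − 1 in the following sense: for every z ∈ V(p) and every δ > 0 there exists w ∈ V(p) with ‖w − z‖ < δ such that w has a neighborhood in V(p) (in the subspace topology induced from ℂⁿ) that is homeomorphic to an open ball in ℝ^{2(n−1)}. -/
open MvPolynomial

open Filter Topology

section LocalStructure

variable {E : Type*} [NormedAddCommGroup E] [NormedSpace ℂ E]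

/-- Zeros on complex lines persist: if `f` vanishes at `w` but not identically on the line through
`w` in direction `v`, then nearby parallel lines contain zeros of `f` close to `w`. -/
theorem eventually_exists_zero_on_line {f : E → ℂ} (hf : Differentiable ℂ f) {v w : E}
    (hw : f w = 0) (hne : ∀ᶠ t : ℂ in 𝓝[≠] 0, f (w + t • v) ≠ 0) {ε : ℝ} (hε : 0 < ε) :
    ∀ᶠ x in 𝓝 w, ∃ t : ℂ, ‖t‖ < ε ∧ f (x + t • v) = 0 := by
  obtain ⟨r, hr, hball⟩ := Metric.eventually_nhds_iff.1 (eventually_nhdsWithin_iff.1 hne)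
  obtain ⟨s, hs, hsr⟩ := exists_between (lt_min hr hε)
  have hsphere : ∀ t ∈ Metric.sphere (0 : ℂ) s, f (w + t • v) ≠ 0 := by
    intro t ht
    have ht' : ‖t‖ = s := by simpa using ht
    refine hball (by simpa [ht'] using hsr.trans_le (min_le_left _ _)) ?_
    rintro rfl
    simp at ht'
    exact hs.ne ht'
  have hc : Continuous f := hf.continuous
  obtain ⟨η, hη, hηf⟩ : ∃ η : ℝ, 0 < η ∧ ∀ t ∈ Metric.sphere (0 : ℂ) s, η < ‖f (w + t • v)‖ := by
    obtain ⟨t₀, ht₀, hmin⟩ := (isCompact_sphere (0 : ℂ) s).exists_isMinOn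
      (NormedSpace.sphere_nonempty.2 hs.le)
      (f := fun t => ‖f (w + t • v)‖) (by fun_prop)
    have h0 : 0 < ‖f (w + t₀ • v)‖ := norm_pos_iff.2 (hsphere t₀ ht₀)
    exact ⟨_, half_pos h0, fun t ht => (half_lt_self h0).trans_le (hmin ht)⟩
  have h1 : ∀ᶠ x in 𝓝 w, ∀ t ∈ Metric.sphere (0 : ℂ) s, η < ‖f (x + t • v) - f x‖ := by
    refine (isCompact_sphere (0 : ℂ) s).eventually_forall_of_forall_eventually fun t ht => ?_
    have hcont : Continuous fun z : E × ℂ => ‖f (z.1 + z.2 • v) - f z.1‖ := by fun_prop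
    exact hcont.continuousAt.eventually_const_lt (by simpa [hw] using hηf t ht)
  have h2 : ∀ᶠ x in 𝓝 w, ‖f x‖ < η / 2 :=
    hc.norm.continuousAt.eventually_lt_const (by simpa [hw] using hη)
  filter_upwards [h1, h2] with x hx1 hx2
  have hd : Differentiable ℂ fun t : ℂ => f (x + t • v) := by fun_prop
  have hfreq : ∃ᶠ t in 𝓝 (0 : ℂ), f (x + t • v) ≠ f (x + (0 : ℂ) • v) := by
    intro hev
    have hconst := AnalyticOnNhd.eq_of_eventuallyEq
      (hd.differentiableOn.analyticOnNhd isOpen_univ)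
      (analyticOnNhd_const (v := f (x + (0 : ℂ) • v))) (z₀ := 0)
      (by filter_upwards [hev] with t ht using not_not.1 ht)
    obtain ⟨t, ht⟩ := NormedSpace.sphere_nonempty (E := ℂ) (x := 0) |>.2 hs.le
    have := hx1 t ht
    rw [congrFun hconst t] at this
    simp at this
    linarith
  have := hd.diffContOnCl.ball_subset_image_closedBall hs
    (fun t ht => by simpa using (hx1 t ht).le) hfreq
  obtain ⟨t, ht, hzero⟩ := this (show (0 : ℂ) ∈ _ by simpa using hx2)
  exact ⟨t, (by simpa using ht : ‖t‖ ≤ s).trans_lt (hsr.trans_le (min_le_right _ _)), hzero⟩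

/-- A map whose strict derivative does not vanish on `v` is injective on short segments in
direction `v`, uniformly near the base point. -/
theorem HasStrictFDerivAt.eventually_eq_zero_of_line {q : E → ℂ} {q' : E →L[ℂ] ℂ} {w v : E}
    (hq : HasStrictFDerivAt q q' w) (hv : q' v ≠ 0) :
    ∀ᶠ z : E × ℂ in 𝓝 (w, 0), q (z.1 + z.2 • v) = q z.1 → z.2 = 0 := by
  have hpos : 0 < ‖q' v‖ := norm_pos_iff.2 hv
  have hc : 0 < ‖q' v‖ / (2 * (‖v‖ + 1)) := by positivity
  have ht : Tendsto (fun z : E × ℂ => (z.1 + z.2 • v, z.1)) (𝓝 (w, 0)) (𝓝 (w, w)) := by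
    have : Continuous fun z : E × ℂ => (z.1 + z.2 • v, z.1) := by fun_prop
    simpa using this.tendsto (w, (0 : ℂ))
  filter_upwards [ht.eventually (hq.isLittleO.def hc)] with z hz heq
  by_contra hne
  have hz0 : 0 < ‖z.2‖ := norm_pos_iff.2 hne
  simp only [heq, sub_self, zero_sub, norm_neg, add_sub_cancel_left, map_smul, norm_smul] at hz
  have : ‖q' v‖ / (2 * (‖v‖ + 1)) * (‖z.2‖ * ‖v‖) < ‖z.2‖ * ‖q' v‖ := by
    rw [div_mul_eq_mul_div, div_lt_iff₀ (by positivity)]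
    have := mul_pos hz0 hpos
    nlinarith [mul_nonneg this.le (norm_nonneg v)]
  linarith

/-- A set which near `w` is the zero locus of a function with nonzero strict derivative is locally
homeomorphic to a real ball of dimension `2 * (dim E - 1)`. -/
theorem HasStrictFDerivAt.exists_isOpen_homeomorph_ball [FiniteDimensional ℂ E]
    {q : E → ℂ} {q' : E →L[ℂ] ℂ} {w : E} (hq : HasStrictFDerivAt q q' w) (hq' : q' ≠ 0)
    {S : Set E} (hw : w ∈ S) (hS : ∀ᶠ x in 𝓝 w, x ∈ S ↔ q x = 0) :
    ∃ U : Set S, IsOpen U ∧ ⟨w, hw⟩ ∈ U ∧ Nonempty (U ≃ₜ Metric.ball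
      (0 : EuclideanSpace ℝ (Fin (2 * (Module.finrank ℂ E - 1)))) 1) := by
  have := FiniteDimensional.complete ℂ E
  have hne : (q' : E →ₗ[ℂ] ℂ) ≠ 0 := fun h => hq' (by ext x; exact LinearMap.congr_fun h x)
  have hrange : q'.range = ⊤ := LinearMap.range_eq_top.2 (LinearMap.surjective hne)
  have hqw : q w = 0 := hS.self_of_nhds.1 hw
  let e := hq.implicitToOpenPartialHomeomorph q q' hrange
  have hfst : ∀ x, (e x).1 = q x := hq.implicitToOpenPartialHomeomorph_fst hrange
  have hew : e w = (0, 0) := by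
    rw [← hqw]; exact hq.implicitToOpenPartialHomeomorph_self hrange
  have hws : w ∈ e.source := hq.mem_implicitToOpenPartialHomeomorph_source hrange
  have hdim : Module.finrank ℝ q'.ker =
      Module.finrank ℝ (EuclideanSpace ℝ (Fin (2 * (Module.finrank ℂ E - 1)))) := by
    have h1 := Module.Dual.finrank_ker_add_one_of_ne_zero hne
    rw [finrank_real_of_complex, finrank_euclideanSpace_fin]
    have h2 : Module.finrank ℂ q'.ker + 1 = Module.finrank ℂ E := h1
    omega
  let L := ContinuousLinearEquiv.ofFinrankEq (𝕜 := ℝ) hdim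
  obtain ⟨W, hWS, hWo, hwW⟩ := eventually_nhds_iff.1 hS
  let e' := e.restrOpen W hWo
  have hwe' : w ∈ e'.source := ⟨hws, hwW⟩
  have h0 : ((0 : ℂ), (0 : q'.ker)) ∈ e'.target := by
    have := e'.map_source hwe'
    rwa [show e' w = (0, 0) from hew] at this
  let G : EuclideanSpace ℝ (Fin (2 * (Module.finrank ℂ E - 1))) → ℂ × q'.ker :=
    fun y => (0, L.symm y)
  have hG : Continuous G := by fun_prop
  obtain ⟨r, hr, hrG⟩ := Metric.isOpen_iff.1 (e'.open_target.preimage hG) 0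
    (by simpa [G] using h0)
  have hGt : ∀ y : Metric.ball (0 : EuclideanSpace ℝ (Fin (2 * (Module.finrank ℂ E - 1)))) 1,
      G (r • y.1) ∈ e'.target := by
    intro y
    apply hrG
    have hy : ‖y.1‖ < 1 := mem_ball_zero_iff.1 y.2
    rw [mem_ball_zero_iff, norm_smul, Real.norm_of_nonneg hr.le]
    nlinarith
  have hGS : ∀ y : Metric.ball (0 : EuclideanSpace ℝ (Fin (2 * (Module.finrank ℂ E - 1)))) 1,
      e'.symm (G (r • y.1)) ∈ S := by
    intro y
    have h1 := e'.map_target (hGt y)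
    refine (hWS _ h1.2).2 ?_
    rw [← hfst]
    exact congrArg Prod.fst (e'.right_inv (hGt y))
  have hcL : ContinuousOn (fun x => r⁻¹ • L (e' x).2) e'.source :=
    ((continuous_const_smul r⁻¹).comp (L.continuous.comp continuous_snd)).comp_continuousOn
      e'.continuousOn
  let O : Set E := e'.source ∩ (fun x => r⁻¹ • L (e' x).2) ⁻¹' Metric.ball 0 1
  have hO : IsOpen O := hcL.isOpen_inter_preimage e'.open_source Metric.isOpen_ball
  refine ⟨Subtype.val ⁻¹' O, hO.preimage continuous_subtype_val, ⟨hwe', ?_⟩, ⟨?_⟩⟩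
  · simp [show e' w = (0, 0) from hew]
  · have hval : ∀ y : Metric.ball (0 : EuclideanSpace ℝ (Fin (2 * (Module.finrank ℂ E - 1)))) 1,
        r⁻¹ • L (e' (e'.symm (G (r • y.1)))).2 = y := by
      intro y
      rw [e'.right_inv (hGt y)]
      simp [G, smul_smul, inv_mul_cancel₀ hr.ne']
    exact
    { toFun := fun x => ⟨r⁻¹ • L (e' x).2, x.2.2⟩
      invFun := fun y => ⟨⟨e'.symm (G (r • y.1)), hGS y⟩,
        e'.map_target (hGt y), by
          rw [Set.mem_preimage, hval]
          exact y.2⟩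
      left_inv := by
        rintro ⟨⟨x, hxS⟩, hx⟩
        have hx1 : x ∈ e'.source := hx.1
        have hx0 : (e' x).1 = 0 := (hfst x).trans ((hWS x hx1.2).1 hxS)
        have : G (r • r⁻¹ • L (e' x).2) = e' x := by
          refine Prod.ext hx0.symm ?_
          simp [G, smul_smul, mul_inv_cancel₀ hr.ne']
        simp only [this, e'.left_inv hx1]
      right_inv := fun y => Subtype.ext (hval y)
      continuous_toFun := by
        refine Continuous.subtype_mk (hcL.comp_continuous
          (continuous_subtype_val.comp continuous_subtype_val) fun x => x.2.1) _
      continuous_invFun := by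
        refine Continuous.subtype_mk (Continuous.subtype_mk
          (e'.symm.continuousOn.comp_continuous (f := fun y :
            Metric.ball (0 : EuclideanSpace ℝ (Fin (2 * (Module.finrank ℂ E - 1)))) 1 =>
            G (r • y.1)) (by fun_prop) hGt) _) _ }

end LocalStructure

namespace MvPolynomial

variable {n : ℕ}

theorem analyticOnNhd_eval_euclideanSpace (p : MvPolynomial (Fin n) ℂ) :
    AnalyticOnNhd ℂ (fun x : EuclideanSpace ℂ (Fin n) => eval (fun i => x i) p) Set.univ :=
  AnalyticOnNhd.aeval_mvPolynomial
    (fun i => (EuclideanSpace.proj i : EuclideanSpace ℂ (Fin n) →L[ℂ] ℂ).analyticOnNhd _) p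

/-- Differentiating along the line `t ↦ x + t • v` is the derivation sending `X i` to `v i`. -/
theorem hasDerivAt_eval_line (p : MvPolynomial (Fin n) ℂ) (x v : EuclideanSpace ℂ (Fin n)) (t : ℂ) :
    HasDerivAt (fun t : ℂ => eval (fun i => (x + t • v) i) p)
      (eval (fun i => (x + t • v) i) (mkDerivation ℂ (fun i => C (v i)) p)) t := by
  induction p using MvPolynomial.induction_on with
  | C a => simpa using hasDerivAt_const t a
  | add p q hp hq => simpa using! hp.fun_add hq
  | mul_X p i hp =>
    have hX : HasDerivAt (fun t : ℂ => (x + t • v) i) (v i) t := by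
      simpa using ((hasDerivAt_id t).mul_const (v i)).const_add (x i)
    have := hp.fun_mul hX
    simp only [map_mul, eval_X, Derivation.leibniz, mkDerivation_X, smul_eq_mul, map_add, eval_C]
    refine this.congr_deriv ?_
    ring

theorem iteratedDeriv_eval_line (p : MvPolynomial (Fin n) ℂ) (x v : EuclideanSpace ℂ (Fin n))
    (k : ℕ) :
    iteratedDeriv k (fun t : ℂ => eval (fun i => (x + t • v) i) p) =
      fun t => eval (fun i => (x + t • v) i) ((mkDerivation ℂ (fun i => C (v i)))^[k] p) := by
  induction k with
  | zero => simp
  | succ k ih =>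
    rw [iteratedDeriv_succ, ih]
    funext t
    rw [(hasDerivAt_eval_line _ x v t).deriv, Function.iterate_succ_apply']

end MvPolynomial

/-- The complex variety of a non-constant polynomial in `n` variables has complex
dimension `n - 1`: arbitrarily close to every point of the variety there is a point
having a neighborhood (in the subspace topology) homeomorphic to an open ball in
`ℝ^(2(n-1))`. -/
theorem stmt2 {n : ℕ} (p : MvPolynomial (Fin n) ℂ) (hp : p.totalDegree ≠ 0) :
    ∀ z : EuclideanSpace ℂ (Fin n), eval (fun i => z i) p = 0 →
    ∀ δ : ℝ, 0 < δ →
    ∃ w : EuclideanSpace ℂ (Fin n), ∃ hw : eval (fun i => w i) p = 0,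
      dist w z < δ ∧
      ∃ U : Set {v : EuclideanSpace ℂ (Fin n) // eval (fun i => v i) p = 0},
        IsOpen U ∧ (⟨w, hw⟩ : {v : EuclideanSpace ℂ (Fin n) // eval (fun i => v i) p = 0}) ∈ U ∧
        Nonempty (U ≃ₜ (Metric.ball (0 : EuclideanSpace ℝ (Fin (2 * (n - 1)))) 1)) := by
  intro z hz δ hδ
  have hp0 : p ≠ 0 := by rintro rfl; simp at hp
  obtain ⟨a, ha⟩ : ∃ a : Fin n → ℂ, eval a p ≠ 0 := by
    by_contra! h
    exact hp0 (MvPolynomial.funext fun x => by simpa using h x)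
  let v : EuclideanSpace ℂ (Fin n) := WithLp.toLp 2 a - z
  let D := mkDerivation ℂ (fun i => (C (v i) : MvPolynomial (Fin n) ℂ))
  let F : MvPolynomial (Fin n) ℂ → EuclideanSpace ℂ (Fin n) → ℂ := fun q x => eval (fun i => x i) q
  have hF : ∀ q, Differentiable ℂ (F q) := fun q x =>
    (analyticOnNhd_eval_euclideanSpace q x trivial).differentiableAt
  have hline : ∀ q x, Differentiable ℂ fun t : ℂ => F q (x + t • v) := fun q x =>
    (hF q).comp (by fun_prop)
  have hex : ∃ k, ∃ w, F p w = 0 ∧ dist w z < δ ∧ F (D^[k] p) w ≠ 0 := by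
    by_contra! h
    apply ha
    have htaylor := Complex.taylorSeries_eq_of_entire (hline p z) 0 1
    have hzero : ∀ k, iteratedDeriv k (fun t : ℂ => F p (z + t • v)) 0 = 0 := fun k => by
      rw [iteratedDeriv_eval_line p z v k]
      simpa using h k z hz (by simpa using hδ)
    simp only [hzero, smul_zero, tsum_zero] at htaylor
    simpa [F, v] using htaylor.symm
  classical
  obtain ⟨w, hw, hwz, hwk⟩ := Nat.find_spec hex
  obtain ⟨m, hm⟩ : ∃ m, Nat.find hex = m + 1 := by
    refine Nat.exists_eq_succ_of_ne_zero fun h => ?_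
    rw [h] at hwk
    exact hwk hw
  rw [hm, Function.iterate_succ_apply'] at hwk
  let q := D^[m] p
  have hqzero : ∀ x, F p x = 0 → dist x z < δ → F q x = 0 := fun x hx hxz => by
    by_contra hne
    exact Nat.find_min hex (m := m) (by omega) ⟨x, hx, hxz, hne⟩
  have hqstrict : HasStrictFDerivAt (F q) (fderiv ℂ (F q) w) w :=
    (analyticOnNhd_eval_euclideanSpace q w trivial).hasStrictFDerivAt
  have hqv : fderiv ℂ (F q) w v = F (D q) w := by
    have h1 : HasDerivAt (fun t : ℂ => F q (w + t • v)) (F (D q) w) 0 := by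
      simpa [F] using hasDerivAt_eval_line q w v 0
    have h2 : HasLineDerivAt ℂ (F q) (fderiv ℂ (F q) w v) w v :=
      hqstrict.hasFDerivAt.hasLineDerivAt v
    exact HasDerivAt.unique h2 h1
  have hqv0 : fderiv ℂ (F q) w v ≠ 0 := by rw [hqv]; exact hwk
  have hne : ∀ᶠ t : ℂ in 𝓝[≠] 0, F p (w + t • v) ≠ 0 := by
    refine ((hline p w).analyticAt 0).eventually_eq_zero_or_eventually_ne_zero.resolve_left
      fun h => hwk ?_
    have h1 := Filter.EventuallyEq.iteratedDeriv_eq (m + 1)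
      (show (fun t : ℂ => F p (w + t • v)) =ᶠ[𝓝 0] fun _ => 0 from h)
    rw [iteratedDeriv_eval_line p w v (m + 1), Function.iterate_succ_apply'] at h1
    simpa using h1
  have hS : ∀ᶠ x in 𝓝 w, x ∈ {x | F p x = 0} ↔ F q x = 0 := by
    have hball : ∀ᶠ x in 𝓝 w, dist x z < δ :=
      (continuous_id.dist continuous_const).continuousAt.eventually_lt_const hwz
    have hmove : Tendsto (fun y : EuclideanSpace ℂ (Fin n) × ℂ => y.1 + y.2 • v)
        (𝓝 (w, 0)) (𝓝 w) := by
      have : Continuous fun y : EuclideanSpace ℂ (Fin n) × ℂ => y.1 + y.2 • v := by fun_prop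
      simpa using this.tendsto (w, (0 : ℂ))
    obtain ⟨P, hP, Q, hQ, hPQ⟩ := eventually_prod_iff.1 <| by
      simpa only [nhds_prod_eq] using
        (hqstrict.eventually_eq_zero_of_line hqv0).and (hmove.eventually hball)
    obtain ⟨ε, hε, hεQ⟩ := Metric.eventually_nhds_iff.1 hQ
    filter_upwards [hball, hP, eventually_exists_zero_on_line (hF p) hw hne hε] with x hxz hxP hxt
    refine ⟨fun hx => hqzero x hx hxz, fun hx => ?_⟩
    obtain ⟨t, ht, hpt⟩ := hxt
    obtain ⟨h1, h2⟩ := hPQ hxP (hεQ (y := t) (by simpa using ht))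
    have ht0 : t = 0 := h1 ((hqzero _ hpt h2).trans hx.symm)
    simpa [ht0] using hpt
  obtain ⟨U, hU, hwU, hhomeo⟩ := hqstrict.exists_isOpen_homeomorph_ball
    (fun h => hqv0 (by simp [h])) (S := {x | F p x = 0}) hw hS
  rw [finrank_euclideanSpace_fin] at hhomeo
  exact ⟨w, hw, hwz, U, hU, hwU, hhomeo⟩
end

section
/- Let p : ℂⁿ → ℂ be a non-constant polynomial whose variety V(p) is allowable. Then V(p) is equal to a finite union of allowable hyperplanes (no proper intersections are needed). -/
/-- An allowable hyperplane in `Kⁿ` is one of `{x : x i = 0}`, `{x : x i + x j = 0}`,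
`{x : x i - x j = 0}`. -/
def IsAllowableHyperplane {K : Type*} [Ring K] {n : ℕ} (H : Set (Fin n → K)) : Prop :=
  (∃ i : Fin n, H = {x | x i = 0}) ∨
  (∃ i j : Fin n, H = {x | x i + x j = 0}) ∨
  (∃ i j : Fin n, H = {x | x i - x j = 0})

/-- A set is allowable if it is a finite union of finite (nonempty) intersections of
allowable hyperplanes. -/
def IsAllowable {K : Type*} [Ring K] {n : ℕ} (A : Set (Fin n → K)) : Prop :=
  ∃ 𝒢 : Finset (Finset (Set (Fin n → K))),
    (∀ G ∈ 𝒢, G.Nonempty ∧ ∀ H ∈ G, IsAllowableHyperplane H) ∧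
    A = ⋃ G ∈ 𝒢, ⋂₀ (G : Set (Set (Fin n → K)))

open MvPolynomial in
theorem IsAllowableHyperplane.exists_totalDegree_le_one {K : Type*} [CommRing K] [Nontrivial K]
    {n : ℕ} {H : Set (Fin n → K)} (hH : IsAllowableHyperplane H) :
    ∃ l : MvPolynomial (Fin n) K, l.totalDegree ≤ 1 ∧ H = {x | eval x l = 0} := by
  obtain ⟨i, rfl⟩ | ⟨i, j, rfl⟩ | ⟨i, j, rfl⟩ := hH
  · exact ⟨X i, by simp, by simp⟩
  · exact ⟨X i + X j, (totalDegree_add _ _).trans (by simp), by simp⟩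
  · exact ⟨X i - X j, (totalDegree_sub _ _).trans (by simp), by simp⟩

namespace MvPolynomial

variable {σ K : Type*} [Field K]

theorem isUnit_of_totalDegree_eq_zero {p : MvPolynomial σ K} (hp : p ≠ 0)
    (h : p.totalDegree = 0) : IsUnit p := by
  rw [totalDegree_eq_zero_iff_eq_C] at h
  rw [h] at hp ⊢
  exact (IsUnit.mk0 _ fun h0 => hp (by rw [h0, C_0])).map C

/-- A nonzero polynomial of total degree at most one is associated to each of its irreducible
divisors. -/
theorem associated_of_irreducible_of_dvd_of_totalDegree_le_one {q l : MvPolynomial σ K}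
    (hq : Irreducible q) (hl : l ≠ 0) (hdeg : l.totalDegree ≤ 1) (h : q ∣ l) :
    Associated q l := by
  obtain ⟨r, rfl⟩ := h
  have hr : r ≠ 0 := right_ne_zero_of_mul hl
  rw [totalDegree_mul_of_isDomain hq.ne_zero hr] at hdeg
  have hq0 : q.totalDegree ≠ 0 := fun h0 =>
    hq.not_isUnit (isUnit_of_totalDegree_eq_zero hq.ne_zero h0)
  exact associated_mul_unit_right q r (isUnit_of_totalDegree_eq_zero hr (by omega))

theorem eval_eq_zero_of_dvd {p q : MvPolynomial σ K} {x : σ → K} (h : p ∣ q)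
    (hp : eval x p = 0) : eval x q = 0 :=
  zero_dvd_iff.mp (hp ▸ map_dvd (eval x) h)

/-- Every zero of a nonzero polynomial is a zero of one of its irreducible factors. -/
theorem exists_irreducible_dvd_of_eval_eq_zero (p : MvPolynomial σ K) (hp : p ≠ 0) (x : σ → K)
    (hx : eval x p = 0) : ∃ q, Irreducible q ∧ q ∣ p ∧ eval x q = 0 := by
  obtain ⟨f, hf, hfp⟩ := UniqueFactorizationMonoid.exists_prime_factors p hp
  have h0 : eval x f.prod = 0 := eval_eq_zero_of_dvd hfp.symm.dvd hx
  rw [map_multiset_prod, Multiset.prod_eq_zero_iff, Multiset.mem_map] at h0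
  obtain ⟨q, hqf, hq⟩ := h0
  exact ⟨q, (hf q hqf).irreducible, (Multiset.dvd_prod hqf).trans hfp.dvd, hq⟩

/-- Over an algebraically closed field, an irreducible polynomial divides every polynomial
vanishing on its variety. -/
theorem dvd_of_irreducible_of_forall_eval_eq_zero [Finite σ] [IsAlgClosed K]
    {q f : MvPolynomial σ K} (hq : Irreducible q) (h : ∀ x, eval x q = 0 → eval x f = 0) :
    q ∣ f := by
  have : (Ideal.span {q}).IsPrime := (Ideal.span_singleton_prime hq.ne_zero).mpr hq.prime
  rw [← Ideal.mem_span_singleton, ← IsPrime.vanishingIdeal_zeroLocus (K := K) (Ideal.span {q}),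
    mem_vanishingIdeal_iff]
  intro x hx
  exact h x (hx q (Ideal.mem_span_singleton_self q))

end MvPolynomial

/-- A non-constant complex polynomial with allowable variety has a variety that is a
finite union of allowable hyperplanes (no proper intersections are needed). -/
theorem stmt3 {n : ℕ} (p : MvPolynomial (Fin n) ℂ) (hp : p.totalDegree ≠ 0)
    (hall : IsAllowable {x : Fin n → ℂ | MvPolynomial.eval x p = 0}) :
    ∃ 𝒮 : Finset (Set (Fin n → ℂ)),
      (∀ H ∈ 𝒮, IsAllowableHyperplane H) ∧
      {x : Fin n → ℂ | MvPolynomial.eval x p = 0} = ⋃₀ (𝒮 : Set (Set (Fin n → ℂ))) := by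
  classical
  obtain ⟨𝒢, h𝒢, hV⟩ := hall
  set V := {x : Fin n → ℂ | MvPolynomial.eval x p = 0}
  have hp0 : p ≠ 0 := by
    rintro rfl
    simp at hp
  have key : ∀ G ∈ 𝒢, ∃ l : MvPolynomial (Fin n) ℂ, l ≠ 0 ∧ l.totalDegree ≤ 1 ∧
      IsAllowableHyperplane {x | MvPolynomial.eval x l = 0} ∧
      ⋂₀ (G : Set (Set (Fin n → ℂ))) ⊆ {x | MvPolynomial.eval x l = 0} := by
    intro G hG
    obtain ⟨H, hHG, hH⟩ : ∃ H ∈ G, H ≠ Set.univ := by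
      by_contra! hcon
      refine hp0 (MvPolynomial.funext fun x => ?_)
      have hx : x ∈ V := by
        rw [hV]
        refine Set.mem_biUnion hG fun H hHG => ?_
        rw [hcon H hHG]
        trivial
      simpa [V] using hx
    have hallow := (h𝒢 G hG).2 H hHG
    obtain ⟨l, hdeg, rfl⟩ := hallow.exists_totalDegree_le_one
    exact ⟨l, fun hl => hH (by simp [hl]), hdeg, hallow, Set.sInter_subset_of_mem hHG⟩
  choose! L hL0 hLdeg hLallow hLsub using key
  refine ⟨{H ∈ 𝒢.image fun G => {x | MvPolynomial.eval x (L G) = 0} | H ⊆ V}, ?_,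
    Set.Subset.antisymm ?_ ?_⟩
  · intro H hH
    obtain ⟨G, hG, rfl⟩ := Finset.mem_image.mp (Finset.mem_filter.mp hH).1
    exact hLallow G hG
  · intro x hx
    obtain ⟨q, hq, hqp, hqx⟩ := p.exists_irreducible_dvd_of_eval_eq_zero hp0 x hx
    have hdvd : q ∣ ∏ G ∈ 𝒢, L G := by
      refine MvPolynomial.dvd_of_irreducible_of_forall_eval_eq_zero hq fun y hy => ?_
      have hyV : y ∈ V := MvPolynomial.eval_eq_zero_of_dvd hqp hy
      rw [hV] at hyV
      obtain ⟨G, hG, hyG⟩ := Set.mem_iUnion₂.mp hyV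
      exact MvPolynomial.eval_eq_zero_of_dvd (Finset.dvd_prod_of_mem L hG) (hLsub G hG hyG)
    obtain ⟨G, hG, hqG⟩ := hq.prime.exists_mem_finset_dvd hdvd
    have hassoc := MvPolynomial.associated_of_irreducible_of_dvd_of_totalDegree_le_one hq
      (hL0 G hG) (hLdeg G hG) hqG
    refine ⟨_, Finset.mem_coe.mpr (Finset.mem_filter.mpr
      ⟨Finset.mem_image_of_mem _ hG, fun y hy => ?_⟩), MvPolynomial.eval_eq_zero_of_dvd hqG hqx⟩
    exact MvPolynomial.eval_eq_zero_of_dvd (hassoc.symm.dvd.trans hqp) hy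
  · exact Set.sUnion_subset fun H hH => (Finset.mem_filter.mp hH).2
end

section
/- For every field F and every n ≥ 1, the determinant of the generic n×n Toeplitz matrix — the matrix T with T_{i,j} = x_{j−i}, where x_{1−n}, x_{2−n}, …, x_{n−1} are 2n−1 independent indeterminates — is an irreducible element of the polynomial ring F[x_{1−n},…,x_{n−1}]. -/
/-- A determinant whose entries lie in a subalgebra lies in that subalgebra. -/
theorem det_mem_subalgebra {R A ι : Type*} [CommRing R] [CommRing A] [Algebra R A]
    [Fintype ι] [DecidableEq ι] (S : Subalgebra R A) (M : Matrix ι ι A)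
    (h : ∀ i j, M i j ∈ S) : M.det ∈ S := by
  rw [Matrix.det_apply']
  exact sum_mem fun σ _ => mul_mem (intCast_mem S _) (prod_mem fun i _ => h _ _)

open MvPolynomial in
/-- A Toeplitz determinant in pairwise distinct indeterminates is irreducible. -/
theorem irreducible_det_toeplitz {F σ : Type*} [Field F] (n : ℕ) (v : ℤ → σ)
    (hv : Set.InjOn v (Set.Ioo (-(n + 1 : ℤ)) (n + 1))) :
    Irreducible (Matrix.det (Matrix.of fun i j : Fin (n + 1) =>
      (X (v ((j : ℤ) - (i : ℤ))) : MvPolynomial σ F))) := by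
  classical
  induction n generalizing v with
  | zero => simpa using (X_prime (i := v 0)).irreducible
  | succ m ih =>
    set T : Matrix (Fin (m + 2)) (Fin (m + 2)) (MvPolynomial σ F) :=
      Matrix.of fun i j => X (v ((j : ℤ) - (i : ℤ))) with hT
    set M := (T.submatrix Fin.succ Fin.castSucc).det with hM
    have hirr : Irreducible M := by
      have := ih (fun k => v (k - 1)) (by
        intro a ha b hb hab
        simp only [Set.mem_Ioo] at ha hb
        have := hv (x₁ := a - 1) (x₂ := b - 1) (by simp; omega) (by simp; omega) hab
        omega)
      convert this using 2
      ext1 i j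
      simp only [hT, Matrix.submatrix_apply, Matrix.of_apply, Fin.val_succ, Fin.val_castSucc]
      congr 2
      push_cast
      ring
    have hmem (j : Fin (m + 2)) :
        (T.submatrix Fin.succ j.succAbove).det ∈ supported F {v (m + 1)}ᶜ := by
      refine det_mem_subalgebra _ _ fun i k => ?_
      simp only [hT, Matrix.submatrix_apply, Matrix.of_apply, X_mem_supported,
        Set.mem_compl_iff, Set.mem_singleton_iff]
      intro h
      have h1 := (j.succAbove k).isLt
      have h2 := i.succ.isLt
      have h3 := Fin.val_succ i
      have := hv (by simp only [Set.mem_Ioo]; omega) (by simp only [Set.mem_Ioo]; omega) h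
      omega
    have hnot {p : MvPolynomial σ F} (hp : p ∈ supported F {v (m + 1)}ᶜ) :
        v (m + 1) ∉ p.vars := fun h => mem_supported.mp hp h rfl
    set g := ∑ j : Fin (m + 1), (-1) ^ (j : ℕ) * T 0 j.castSucc *
      (T.submatrix Fin.succ j.castSucc.succAbove).det with hg
    have hdet : T.det = (-1) ^ (m + 1) * M * X (v (m + 1)) + g := by
      have hX : T 0 (Fin.last (m + 1)) = X (v (m + 1)) := by simp [hT]
      rw [Matrix.det_succ_row_zero, Fin.sum_univ_castSucc, add_comm, Fin.succAbove_last, hX,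
        Fin.val_last, mul_right_comm]
      rfl
    have hf : Associated M ((-1) ^ (m + 1) * M) :=
      (associated_isUnit_mul_left_iff ((isUnit_one.neg).pow _)).mpr .rfl |>.symm
    have hneg : ∀ k : ℕ, (-1 : MvPolynomial σ F) ^ k ∈ supported F {v (m + 1)}ᶜ :=
      fun k => pow_mem (neg_mem (one_mem _)) k
    rw [hdet]
    refine irreducible_mul_X_add _ _ _ (hf.irreducible hirr).ne_zero (hnot ?_) (hnot ?_) ?_
    · have := hmem (Fin.last _)
      rw [Fin.succAbove_last] at this
      exact mul_mem (hneg _) this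
    · refine sum_mem fun j _ => mul_mem (mul_mem (hneg _) ?_) (hmem _)
      simp only [hT, Matrix.of_apply, X_mem_supported, Set.mem_compl_iff,
        Set.mem_singleton_iff]
      intro h
      have h1 := j.isLt
      have := hv (by simp; omega) (by simp only [Set.mem_Ioo]; omega) h
      simp at this
      omega
    · rw [(hf.irreducible hirr).isRelPrime_iff_not_dvd]
      intro hdvd
      have hMT : M ∣ T.det := by
        rw [hdet]
        exact dvd_add (Dvd.intro_left _ rfl |>.mul_right _) (hf.dvd.trans hdvd)
      -- Specialize `T` to the identity matrix, whose corner minor vanishes.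
      let φ : MvPolynomial σ F →+* F := eval (Pi.single (v 0) 1)
      have hφT : φ.mapMatrix T = 1 := by
        ext i j
        have hiff : v ((j : ℤ) - (i : ℤ)) = v 0 ↔ i = j := by
          refine ⟨fun h => ?_, fun h => by simp [h]⟩
          have := hv (by simp only [Set.mem_Ioo]; omega) (by simp only [Set.mem_Ioo]; omega) h
          omega
        simp [φ, hT, Pi.single_apply, Matrix.one_apply, hiff]
      have hφM : φ M = 0 := by
        have : φ M = ((φ.mapMatrix T).submatrix Fin.succ Fin.castSucc).det := φ.map_det _
        rw [this, hφT]
        refine Matrix.det_eq_zero_of_row_eq_zero (Fin.last m) fun j => ?_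
        rw [Matrix.submatrix_apply, Fin.succ_last, Matrix.one_apply_ne]
        exact (Fin.castSucc_lt_last j).ne'
      have := map_dvd φ hMT
      rw [hφM, φ.map_det, hφT, Matrix.det_one] at this
      simp at this

/-- The determinant of the generic `n × n` Toeplitz matrix, whose `(i,j)` entry is the
indeterminate `x_{j-i}` (indexed here by `j + (n-1) - i ∈ Fin (2n-1)`), is irreducible in
the polynomial ring over any field `F` in the `2n - 1` indeterminates. -/
theorem stmt10 (F : Type*) [Field F] (n : ℕ) (hn : 1 ≤ n) :
    Irreducible (Matrix.det (Matrix.of fun i j : Fin n =>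
      (MvPolynomial.X ⟨(j : ℕ) + (n - 1) - (i : ℕ), by
        have hi := i.isLt; have hj := j.isLt; omega⟩ :
        MvPolynomial (Fin (2 * n - 1)) F))) := by
  obtain ⟨m, rfl⟩ : ∃ m, n = m + 1 := ⟨n - 1, by omega⟩
  have : NeZero (2 * (m + 1) - 1) := ⟨by omega⟩
  let v : ℤ → Fin (2 * (m + 1) - 1) := fun k => Fin.ofNat _ (k + m).toNat
  have hv : Set.InjOn v (Set.Ioo (-(m + 1 : ℤ)) (m + 1)) := by
    intro a ha b hb h
    simp only [Set.mem_Ioo] at ha hb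
    have := congrArg Fin.val h
    simp only [v, Fin.val_ofNat] at this
    rw [Nat.mod_eq_of_lt (by omega), Nat.mod_eq_of_lt (by omega)] at this
    omega
  convert irreducible_det_toeplitz (F := F) m v hv using 6 with i j
  ext
  simp only [v, Fin.val_ofNat]
  rw [Nat.mod_eq_of_lt (by omega)]
  omega
end
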